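/- Let ε > 0, let λ ≤ 0, and let g : [0,∞) → ℝ be bounded and continuous. If u and v are both twice continuously differentiable on [0,∞), both satisfy ε²·w''(t) = w(t)³ − λ·w(t) + g(t) for all t ≥ 0, both satisfy w'(0) = 0, and both are bounded on [0,∞), then u(t) = v(t) for all t ≥ 0. -/

import Mathlib

open Real Set

/-- A function that is bounded above and convex on `[0,∞)`, with vanishing slope at `0`, has
vanishing derivative on `[0,∞)`. -/
lemma deriv_eq_zero_of_convex_of_bddAbove {p q r : ℝ → ℝ} {M : ℝ}
    (hp : ∀ t, HasDerivAt p (q t) t) (hq : ∀ t, HasDerivAt q (r t) t)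
    (hr : ∀ t, 0 ≤ t → 0 ≤ r t) (hq0 : q 0 = 0) (hM : ∀ t, 0 ≤ t → p t ≤ M) :
    ∀ t, 0 ≤ t → q t = 0 := by
  have hmono : MonotoneOn q (Ici 0) := by
    refine monotoneOn_of_deriv_nonneg (convex_Ici 0)
      (fun t _ => (hq t).continuousAt.continuousWithinAt)
      (fun t _ => (hq t).differentiableAt.differentiableWithinAt) fun t ht => ?_
    rw [(hq t).deriv]
    exact hr t (interior_subset ht)
  intro a ha
  have hqa : 0 ≤ q a := hq0 ▸ hmono self_mem_Ici ha ha
  by_contra hne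
  have hpos : 0 < q a := lt_of_le_of_ne hqa (Ne.symm hne)
  have hgrow : ∀ t, a ≤ t → q a * (t - a) ≤ p t - p a := fun t hat =>
    (convex_Ici a).mul_sub_le_image_sub_of_le_deriv
      (fun t _ => (hp t).continuousAt.continuousWithinAt)
      (fun t _ => (hp t).differentiableAt.differentiableWithinAt)
      (fun t ht => by
        have hat : a ≤ t := interior_subset ht
        rw [(hp t).deriv]
        exact hmono ha (ha.trans hat) hat)
      a self_mem_Ici t hat hat
  have hd : 0 ≤ (M - p a + 1) / q a := div_nonneg (by linarith [hM a ha]) hqa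
  have h₁ := hgrow (a + (M - p a + 1) / q a) (by linarith)
  have h₂ := hM (a + (M - p a + 1) / q a) (by linarith)
  rw [add_sub_cancel_left, mul_div_cancel₀ _ hpos.ne'] at h₁
  linarith

/-- For `ε > 0`, `λ ≤ 0`, and bounded continuous `g` on `[0,∞)`, any two
bounded solutions of `ε²·u'' = u³ − λ·u + g(t)` on `[0,∞)` with `u'(0) = 0`
coincide on `[0,∞)`. -/
theorem stmt_1 (ε lam : ℝ) (hε : 0 < ε) (hlam : lam ≤ 0) (g : ℝ → ℝ)
    (hg_cont : ContinuousOn g (Ici (0 : ℝ)))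
    (hg_bdd : ∃ C : ℝ, ∀ t ∈ Ici (0 : ℝ), |g t| ≤ C)
    (u v : ℝ → ℝ) (hu : ContDiff ℝ 2 u) (hv : ContDiff ℝ 2 v)
    (hueq : ∀ t ∈ Ici (0 : ℝ), ε ^ 2 * deriv (deriv u) t = u t ^ 3 - lam * u t + g t)
    (hveq : ∀ t ∈ Ici (0 : ℝ), ε ^ 2 * deriv (deriv v) t = v t ^ 3 - lam * v t + g t)
    (hu0 : deriv u 0 = 0) (hv0 : deriv v 0 = 0)
    (hub : ∃ M : ℝ, ∀ t ∈ Ici (0 : ℝ), |u t| ≤ M)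
    (hvb : ∃ M : ℝ, ∀ t ∈ Ici (0 : ℝ), |v t| ≤ M) :
    ∀ t ∈ Ici (0 : ℝ), u t = v t := by
  obtain ⟨M, hM⟩ := hub
  obtain ⟨N, hN⟩ := hvb
  have hderiv : ∀ {f : ℝ → ℝ}, ContDiff ℝ 2 f → ∀ t, HasDerivAt f (deriv f t) t :=
    fun hf t => (hf.differentiable two_ne_zero t).hasDerivAt
  have hderiv2 : ∀ {f : ℝ → ℝ}, ContDiff ℝ 2 f →
      ∀ t, HasDerivAt (deriv f) (deriv (deriv f) t) t := fun hf t =>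
    (((contDiff_succ_iff_deriv (n := 1)).1 hf).2.2.differentiable one_ne_zero t).hasDerivAt
  set p : ℝ → ℝ := fun t => (u t - v t) ^ 2 with hp_def
  set q : ℝ → ℝ := fun t => 2 * ((u t - v t) * (deriv u t - deriv v t)) with hq_def
  set r : ℝ → ℝ := fun t => 2 * ((deriv u t - deriv v t) * (deriv u t - deriv v t) +
    (u t - v t) * (deriv (deriv u) t - deriv (deriv v) t)) with hr_def
  have hp : ∀ t, HasDerivAt p (q t) t := fun t =>
    (((hderiv hu t).sub (hderiv hv t)).pow 2).congr_deriv (by simp [hq_def]; ring)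
  have hq : ∀ t, HasDerivAt q (r t) t := fun t =>
    (((hderiv hu t).sub (hderiv hv t)).mul ((hderiv2 hu t).sub (hderiv2 hv t))).const_mul 2
  have hww : ∀ t, 0 ≤ t →
      ε ^ 2 * ((u t - v t) * (deriv (deriv u) t - deriv (deriv v) t)) =
        (u t - v t) ^ 2 * (u t ^ 2 + u t * v t + v t ^ 2) + -lam * (u t - v t) ^ 2 := by
    intro t ht
    linear_combination (u t - v t) * (hueq t ht - hveq t ht)
  have hquad : ∀ x y : ℝ, 0 ≤ x ^ 2 + x * y + y ^ 2 := fun x y => by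
    nlinarith [sq_nonneg (x + y), sq_nonneg x, sq_nonneg y]
  have hww_nonneg : ∀ t, 0 ≤ t →
      0 ≤ (u t - v t) * (deriv (deriv u) t - deriv (deriv v) t) := by
    intro t ht
    refine nonneg_of_mul_nonneg_right (a := ε ^ 2) ?_ (by positivity)
    rw [hww t ht]
    exact add_nonneg (mul_nonneg (sq_nonneg _) (hquad _ _))
      (mul_nonneg (neg_nonneg.2 hlam) (sq_nonneg _))
  have hq_zero : ∀ t, 0 ≤ t → q t = 0 := by
    refine deriv_eq_zero_of_convex_of_bddAbove (M := (M + N) ^ 2) hp hq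
      (fun t ht => ?_) (by simp [hq_def, hu0, hv0]) fun t ht => ?_
    · exact mul_nonneg zero_le_two (add_nonneg (mul_self_nonneg _) (hww_nonneg t ht))
    · have h := (abs_sub (u t) (v t)).trans (add_le_add (hM t ht) (hN t ht))
      exact sq_le_sq' (abs_le.1 h).1 (abs_le.1 h).2
  have hp_const : ∀ t, 0 ≤ t → p t = p 0 := fun t ht =>
    constant_of_has_deriv_right_zero (fun x _ => (hp x).continuousAt.continuousWithinAt)
      (fun x hx => hq_zero x hx.1 ▸ (hp x).hasDerivWithinAt) t ⟨ht, le_rfl⟩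
  have hr_one : r 1 = 0 := by
    refine (hq 1).unique ((hasDerivAt_const 1 (0 : ℝ)).congr_of_eventuallyEq ?_)
    filter_upwards [Ioi_mem_nhds zero_lt_one] with t ht using hq_zero t (le_of_lt ht)
  have hw_one : u 1 - v 1 = 0 := by
    have h₁ := hww 1 zero_le_one
    have h₂ : (u 1 - v 1) * (deriv (deriv u) 1 - deriv (deriv v) 1) = 0 := by
      have h₃ := hww_nonneg 1 zero_le_one
      simp only [hr_def] at hr_one
      nlinarith [mul_self_nonneg (deriv u 1 - deriv v 1)]
    rw [h₂, mul_zero] at h₁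
    have h₄ := mul_nonneg (neg_nonneg.2 hlam) (sq_nonneg (u 1 - v 1))
    have h₅ := mul_nonneg (sq_nonneg (u 1 - v 1)) (hquad (u 1) (v 1))
    have h₆ : (u 1 - v 1) ^ 2 * (u 1 ^ 2 + u 1 * v 1 + v 1 ^ 2) = 0 := by linarith
    rcases mul_eq_zero.1 h₆ with h | h
    · exact pow_eq_zero_iff two_ne_zero |>.1 h
    · refine pow_eq_zero_iff two_ne_zero |>.1 (le_antisymm ?_ (sq_nonneg _))
      nlinarith [sq_nonneg (u 1 + v 1)]
  intro t ht
  have hpt : p t = 0 := by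
    rw [hp_const t ht, ← hp_const 1 zero_le_one]
    simp [hp_def, hw_one]
  exact sub_eq_zero.1 (pow_eq_zero_iff two_ne_zero |>.1 hpt)
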